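/- arXiv:1810.02716 — 7 statements merged into one kernel-verified Lean document; each statement's English description precedes it below -/
import Mathlib

section
/- Let R : ℝ^p → ℝ be convex and twice continuously differentiable, and let P : ℝ^p → ℝ^p be its proximal operator, i.e. P(u) is the unique minimizer of z ↦ (1/2)‖u − z‖₂² + R(z). Then P is differentiable at every u ∈ ℝ^p, and its Jacobian (Fréchet derivative) is J(u) = [I + ∇²R(P(u))]^{-1}; the inverse exists because ∇²R(P(u)) is symmetric positive semidefinite, so I + ∇²R(P(u)) is positive definite. -/
open Filter Matrix Topology

/-- Hessian matrix of a function on `ℝ^p`. -/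
noncomputable def vhessian {p : ℕ} (R : (Fin p → ℝ) → ℝ) (β : Fin p → ℝ) :
    Matrix (Fin p) (Fin p) ℝ :=
  Matrix.of fun i j => fderiv ℝ (fun b => fderiv ℝ R b (Pi.single j 1)) β (Pi.single i 1)

section Line

variable {E : Type*} [NormedAddCommGroup E] [NormedSpace ℝ E] {R : E → ℝ}

theorem ConvexOn.monotone_fderiv_line (hconv : ConvexOn ℝ Set.univ R)
    (hR : Differentiable ℝ R) (x v : E) :
    Monotone fun t : ℝ => fderiv ℝ R (x + t • v) v := by
  have hline (t : ℝ) : HasDerivAt (fun t : ℝ => x + t • v) v t := by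
    simpa using ((hasDerivAt_id t).smul_const v).const_add x
  have hd (t : ℝ) : HasDerivAt (fun t : ℝ => R (x + t • v)) (fderiv ℝ R (x + t • v) v) t :=
    (hR _).hasFDerivAt.comp_hasDerivAt t (hline t)
  have hc : ConvexOn ℝ Set.univ fun t : ℝ => R (x + t • v) := by
    refine ⟨convex_univ, fun s _ t _ a b ha hb hab => ?_⟩
    have h := hconv.2 (Set.mem_univ (x + s • v)) (Set.mem_univ (x + t • v)) ha hb hab
    convert h using 2
    have hx : x = a • x + b • x := by rw [← add_smul, hab, one_smul]
    nth_rw 1 [hx]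
    simp only [smul_eq_mul]
    module
  have hm := hc.monotoneOn_deriv fun t _ => (hd t).differentiableAt
  intro s t hst
  simpa [(hd s).deriv, (hd t).deriv] using hm (Set.mem_univ s) (Set.mem_univ t) hst

theorem ConvexOn.fderiv_sub_apply_nonneg (hconv : ConvexOn ℝ Set.univ R)
    (hR : Differentiable ℝ R) (x y : E) :
    0 ≤ fderiv ℝ R x (x - y) - fderiv ℝ R y (x - y) := by
  have h := hconv.monotone_fderiv_line hR y (x - y) zero_le_one
  simpa using h

theorem ConvexOn.fderiv_fderiv_apply_self_nonneg (hconv : ConvexOn ℝ Set.univ R)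
    (hR : ContDiff ℝ 2 R) (x v : E) :
    0 ≤ fderiv ℝ (fderiv ℝ R) x v v := by
  have hline : HasDerivAt (fun t : ℝ => x + t • v) v 0 := by
    simpa using ((hasDerivAt_id (0 : ℝ)).smul_const v).const_add x
  have hD : Differentiable ℝ (fderiv ℝ R) :=
    (hR.fderiv_right (m := 1) (by norm_num)).differentiable (by norm_num)
  have h1 : HasFDerivAt (fderiv ℝ R) (fderiv ℝ (fderiv ℝ R) x) (x + (0 : ℝ) • v) := by
    simpa using (hD x).hasFDerivAt
  have h2 : HasDerivAt (fun t : ℝ => fderiv ℝ R (x + t • v) v)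
      (fderiv ℝ (fderiv ℝ R) x v v) 0 := by
    have h3 : HasFDerivAt (fun y => fderiv ℝ R y v)
        ((fderiv ℝ (fderiv ℝ R) x).flip v) (x + (0 : ℝ) • v) :=
      (ContinuousLinearMap.apply ℝ ℝ v).hasFDerivAt.comp (x + (0 : ℝ) • v) h1
    exact h3.comp_hasDerivAt (0 : ℝ) hline
  exact h2.nonneg_of_monotone
    (hconv.monotone_fderiv_line (hR.differentiable (by norm_num)) x v)

end Line

theorem ContinuousLinearMap.apply_eq_sum_single {p : ℕ} (L : (Fin p → ℝ) →L[ℝ] ℝ)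
    (v : Fin p → ℝ) : L v = ∑ i, v i * L (Pi.single i 1) := by
  conv_lhs => rw [pi_eq_sum_univ' v]
  simp [map_sum]

section Hessian

variable {p : ℕ} {R : (Fin p → ℝ) → ℝ}

theorem vhessian_apply (hR : ContDiff ℝ 2 R) (x : Fin p → ℝ) (i j : Fin p) :
    vhessian R x i j = fderiv ℝ (fderiv ℝ R) x (Pi.single i 1) (Pi.single j 1) := by
  have hD : Differentiable ℝ (fderiv ℝ R) :=
    (hR.fderiv_right (m := 1) (by norm_num)).differentiable (by norm_num)
  have h := (hD x).hasFDerivAt.clm_apply (hasFDerivAt_const (Pi.single j (1 : ℝ)) x)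
  simp [vhessian, h.fderiv]

theorem vhessian_symm (hR : ContDiff ℝ 2 R) (x : Fin p → ℝ) (i j : Fin p) :
    vhessian R x i j = vhessian R x j i := by
  rw [vhessian_apply hR, vhessian_apply hR]
  exact hR.contDiffAt.isSymmSndFDerivAt (by simp) _ _

theorem vhessian_mulVec (hR : ContDiff ℝ 2 R) (x v : Fin p → ℝ) (i : Fin p) :
    (vhessian R x *ᵥ v) i = fderiv ℝ (fderiv ℝ R) x v (Pi.single i 1) := by
  rw [hR.contDiffAt.isSymmSndFDerivAt (by simp) v (Pi.single i 1),
    ContinuousLinearMap.apply_eq_sum_single]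
  simp [Matrix.mulVec, dotProduct, vhessian_apply hR, mul_comm]

theorem posDef_one_add_vhessian (hconv : ConvexOn ℝ Set.univ R) (hR : ContDiff ℝ 2 R)
    (x : Fin p → ℝ) : ((1 : Matrix (Fin p) (Fin p) ℝ) + vhessian R x).PosDef := by
  refine Matrix.PosDef.add_posSemidef Matrix.PosDef.one
    (.of_dotProduct_mulVec_nonneg ?_ fun v => ?_)
  · ext i j
    simpa using vhessian_symm hR x j i
  · have h := hconv.fderiv_fderiv_apply_self_nonneg hR x v
    rw [ContinuousLinearMap.apply_eq_sum_single] at h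
    simpa [dotProduct, vhessian_mulVec hR] using h

theorem hasFDerivAt_add_gradient (hR : ContDiff ℝ 2 R) (x : Fin p → ℝ) :
    HasFDerivAt (fun z i => z i + fderiv ℝ R z (Pi.single i 1))
      (LinearMap.toContinuousLinearMap
        (Matrix.mulVecLin ((1 : Matrix (Fin p) (Fin p) ℝ) + vhessian R x))) x := by
  have hD : Differentiable ℝ (fderiv ℝ R) :=
    (hR.fderiv_right (m := 1) (by norm_num)).differentiable (by norm_num)
  rw [hasFDerivAt_pi']
  intro i
  have h := (hasFDerivAt_apply (𝕜 := ℝ) i x).add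
    ((hD x).hasFDerivAt.clm_apply (hasFDerivAt_const (Pi.single i (1 : ℝ)) x))
  refine h.congr_fderiv ?_
  ext v
  simp [vhessian_mulVec hR]

end Hessian

section Prox

variable {p : ℕ} {R : (Fin p → ℝ) → ℝ}

theorem prox_stationarity {u x : Fin p → ℝ} (hR : DifferentiableAt ℝ R x)
    (hmin : ∀ z, (1 / 2) * (∑ i, (u i - x i) ^ 2) + R x
      ≤ (1 / 2) * (∑ i, (u i - z i) ^ 2) + R z) (v : Fin p → ℝ) :
    fderiv ℝ R x v = ∑ i, (u i - x i) * v i := by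
  have hq : HasFDerivAt (fun z : Fin p → ℝ => ∑ i, (u i - z i) ^ 2) _ x :=
    HasFDerivAt.fun_sum fun i _ => ((hasFDerivAt_apply (𝕜 := ℝ) i x).const_sub (u i)).pow 2
  have hd := (hq.const_mul (1 / 2 : ℝ)).add hR.hasFDerivAt
  have hloc : IsLocalMin ((fun z => 1 / 2 * ∑ i, (u i - z i) ^ 2) + R) x :=
    Eventually.of_forall hmin
  have h := DFunLike.congr_fun (hloc.hasFDerivAt_eq_zero hd) v
  simp [Finset.mul_sum] at h
  have hsum : ∑ i, 2⁻¹ * (2 * (u i - x i) * v i) = ∑ i, (u i - x i) * v i :=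
    Finset.sum_congr rfl fun i _ => by ring
  linarith

theorem prox_nonexpansive (hconv : ConvexOn ℝ Set.univ R) (hR : Differentiable ℝ R)
    {u v x y : Fin p → ℝ} (hx : ∀ w, fderiv ℝ R x w = ∑ i, (u i - x i) * w i)
    (hy : ∀ w, fderiv ℝ R y w = ∑ i, (v i - y i) * w i) :
    ∑ i, (x i - y i) ^ 2 ≤ ∑ i, (u i - v i) ^ 2 := by
  have h := hconv.fderiv_sub_apply_nonneg hR x y
  rw [hx, hy, ← Finset.sum_sub_distrib] at h
  have h2 : ∑ i, (x i - y i) ^ 2 + 2 * ∑ i, ((u i - x i) * (x - y) i - (v i - y i) * (x - y) i)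
      ≤ ∑ i, (u i - v i) ^ 2 := by
    rw [Finset.mul_sum, ← Finset.sum_add_distrib]
    refine Finset.sum_le_sum fun i _ => ?_
    simp only [Pi.sub_apply]
    nlinarith [sq_nonneg ((u i - v i) - (x i - y i))]
  linarith

theorem continuous_of_sum_sq_le {P : (Fin p → ℝ) → (Fin p → ℝ)}
    (h : ∀ u v, ∑ i, (P u i - P v i) ^ 2 ≤ ∑ i, (u i - v i) ^ 2) : Continuous P := by
  refine continuous_pi fun i => continuous_iff_continuousAt.2 fun u => ?_
  have hlim : Tendsto (fun v : Fin p → ℝ => √(∑ i, (v i - u i) ^ 2)) (𝓝 u) (𝓝 0) := by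
    have hc : Continuous fun v : Fin p → ℝ => √(∑ i, (v i - u i) ^ 2) := by fun_prop
    simpa using hc.tendsto u
  refine tendsto_iff_dist_tendsto_zero.2
    (squeeze_zero (fun _ => dist_nonneg) (fun v => ?_) hlim)
  rw [Real.dist_eq]
  refine Real.abs_le_sqrt (le_trans ?_ (h v u))
  exact Finset.single_le_sum (f := fun i => (P v i - P u i) ^ 2)
    (fun j _ => sq_nonneg _) (Finset.mem_univ i)

end Prox

/-- Let `R : ℝ^p → ℝ` be convex and twice continuously differentiable,
and let `P` be its proximal operator (the unique minimizer of
`z ↦ (1/2)‖u − z‖₂² + R(z)`).  Then `P` is differentiable at every `u`, with Jacobian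
`[I + ∇²R(P u)]⁻¹`; the matrix `I + ∇²R(P u)` is positive definite (hence invertible)
because `∇²R` is positive semidefinite. -/
theorem prox_jacobian_of_smooth_regularizer {p : ℕ}
    (R : (Fin p → ℝ) → ℝ) (P : (Fin p → ℝ) → (Fin p → ℝ))
    (hconv : ConvexOn ℝ Set.univ R)
    (hR : ContDiff ℝ 2 R)
    (hP : ∀ u z, z ≠ P u →
      (1 / 2) * (∑ i, (u i - P u i) ^ 2) + R (P u)
        < (1 / 2) * (∑ i, (u i - z i) ^ 2) + R z) :
    ∀ u : Fin p → ℝ,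
      ((1 : Matrix (Fin p) (Fin p) ℝ) + vhessian R (P u)).PosDef ∧
      HasFDerivAt P
        (LinearMap.toContinuousLinearMap
          (Matrix.mulVecLin (((1 : Matrix (Fin p) (Fin p) ℝ) + vhessian R (P u))⁻¹))) u := by
  have hdiff : Differentiable ℝ R := hR.differentiable (by norm_num)
  have hstat (u v : Fin p → ℝ) : fderiv ℝ R (P u) v = ∑ i, (u i - P u i) * v i := by
    refine prox_stationarity (hdiff _) (fun z => ?_) v
    rcases eq_or_ne z (P u) with rfl | hz
    · exact le_rfl
    · exact (hP u z hz).le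
  have hcont : Continuous P := continuous_of_sum_sq_le fun u v =>
    prox_nonexpansive hconv hdiff (hstat u) (hstat v)
  intro u
  have hpd := posDef_one_add_vhessian hconv hR (P u)
  refine ⟨hpd, ?_⟩
  have hinv : (1 + vhessian R (P u))⁻¹ * (1 + vhessian R (P u)) = 1 :=
    Matrix.nonsing_inv_mul _ ((Matrix.isUnit_iff_isUnit_det _).1 hpd.isUnit)
  have hP' := (hasFDerivAt_add_gradient hR (P u)).of_comp_of_leftInverse
    (f'symm := LinearMap.toContinuousLinearMap
      (Matrix.mulVecLin ((1 : Matrix (Fin p) (Fin p) ℝ) + vhessian R (P u))⁻¹))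
    hcont.continuousAt (hasFDerivAt_id u) (Eventually.of_forall fun v => ?_) fun w => ?_
  · simpa using hP'
  · ext i
    simp [hstat, Pi.single_apply]
  · change (1 + vhessian R (P u))⁻¹ *ᵥ ((1 + vhessian R (P u)) *ᵥ w) = w
    rw [Matrix.mulVec_mulVec, hinv, Matrix.one_mulVec]
end

section
/- Let H_R ∈ ℝ^{p×p} be symmetric positive semidefinite and M ∈ ℝ^{p×p} be such that H_R + M is invertible. Set J̃ = (I + H_R)^{-1} (invertible since I + H_R is positive definite). Then the matrix I − J̃(I − M) is invertible and [I − J̃(I − M)]^{-1} J̃ = (H_R + M)^{-1}. Consequently, for any vectors v, β̂ ∈ ℝ^p and scalar c ∈ ℝ, the proximal-formulation Newton step β̂ + [I − J̃(I − M)]^{-1} J̃ v c coincides with the primal-formulation Newton step β̂ + (H_R + M)^{-1} v c. -/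
open Matrix

/-- Factorization behind the equality of the proximal and primal Newton steps. -/
theorem Matrix.one_sub_inv_mul_one_sub {n R : Type*} [Fintype n] [DecidableEq n] [CommRing R]
    (H M : Matrix n n R) (h : IsUnit (1 + H).det) :
    1 - (1 + H)⁻¹ * (1 - M) = (1 + H)⁻¹ * (H + M) := by
  have hsplit : H + M = (1 + H) - (1 - M) := by abel
  rw [hsplit, Matrix.mul_sub (1 + H)⁻¹ (1 + H), Matrix.nonsing_inv_mul _ h]

/-- For symmetric positive semidefinite `H_R` and any `M` with
`H_R + M` invertible, setting `J̃ = (I + H_R)⁻¹`, the matrix `I − J̃(I − M)` is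
invertible and `[I − J̃(I − M)]⁻¹ J̃ = (H_R + M)⁻¹`; consequently the
proximal-formulation Newton step coincides with the primal-formulation Newton step. -/
theorem proximal_primal_newton_step_eq {p : ℕ}
    (HR M : Matrix (Fin p) (Fin p) ℝ)
    (hHR : HR.PosSemidef)
    (hinv : IsUnit (HR + M).det) :
    IsUnit ((1 : Matrix (Fin p) (Fin p) ℝ) + HR).det ∧
    IsUnit ((1 : Matrix (Fin p) (Fin p) ℝ) - (1 + HR)⁻¹ * (1 - M)).det ∧
    ((1 : Matrix (Fin p) (Fin p) ℝ) - (1 + HR)⁻¹ * (1 - M))⁻¹ * (1 + HR)⁻¹ = (HR + M)⁻¹ ∧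
    ∀ (v βhat : Fin p → ℝ) (c : ℝ),
      βhat + (((1 : Matrix (Fin p) (Fin p) ℝ) - (1 + HR)⁻¹ * (1 - M))⁻¹ * (1 + HR)⁻¹) *ᵥ (c • v)
        = βhat + (HR + M)⁻¹ *ᵥ (c • v) := by
  have hpos : IsUnit ((1 : Matrix (Fin p) (Fin p) ℝ) + HR).det :=
    (Matrix.isUnit_iff_isUnit_det _).mp (Matrix.PosDef.one.add_posSemidef hHR).isUnit
  have hJ : IsUnit ((1 : Matrix (Fin p) (Fin p) ℝ) + HR)⁻¹.det :=
    Matrix.isUnit_nonsing_inv_det _ hpos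
  have hfac := Matrix.one_sub_inv_mul_one_sub HR M hpos
  have heq : ((1 : Matrix (Fin p) (Fin p) ℝ) - (1 + HR)⁻¹ * (1 - M))⁻¹ * (1 + HR)⁻¹
      = (HR + M)⁻¹ := by
    rw [hfac, Matrix.mul_inv_rev, Matrix.mul_assoc, Matrix.nonsing_inv_mul _ hJ, Matrix.mul_one]
  refine ⟨hpos, ?_, heq, fun v βhat c => by rw [heq]⟩
  rw [hfac, Matrix.det_mul]
  exact hJ.mul hinv
end

section
/- Let (A_n)_{n∈ℕ} be a sequence of square real matrices written in block form A_n = fromBlocks(A_{1n}, A_{2n}, A_{3n}, A_{4n}), where the A_{1n} are square of fixed size and A_{4n} are square of fixed size, and assume: A_{4n} is invertible for each n with A_{4n}^{-1} → 0; A_{in} → A_i for i = 1, 2, 3; A_1 is invertible; and for each n the Schur complement A_{1n} − A_{2n} A_{4n}^{-1} A_{3n} is invertible (so A_n is invertible). Then A_n^{-1} → fromBlocks(A_1^{-1}, 0, 0, 0) as n → ∞. -/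
open Filter Matrix Topology

theorem Matrix.inv_fromBlocks_of_isUnit_det₂₂ {m n R : Type*} [Fintype m] [DecidableEq m]
    [Fintype n] [DecidableEq n] [CommRing R] (A : Matrix m m R) (B : Matrix m n R)
    (C : Matrix n m R) (D : Matrix n n R) (hD : IsUnit D.det)
    (hS : IsUnit (A - B * D⁻¹ * C).det) :
    (fromBlocks A B C D)⁻¹ =
      fromBlocks (A - B * D⁻¹ * C)⁻¹ (-((A - B * D⁻¹ * C)⁻¹ * B * D⁻¹))
        (-(D⁻¹ * C * (A - B * D⁻¹ * C)⁻¹))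
        (D⁻¹ + D⁻¹ * C * (A - B * D⁻¹ * C)⁻¹ * B * D⁻¹) := by
  let := invertibleOfIsUnitDet D hD
  rw [← invOf_eq_nonsing_inv D] at hS ⊢
  let := invertibleOfIsUnitDet _ hS
  let := fromBlocks₂₂Invertible A B C D
  simp only [← invOf_eq_nonsing_inv (A - B * ⅟D * C), ← invOf_eq_nonsing_inv (fromBlocks A B C D),
    invOf_fromBlocks₂₂_eq]

theorem Filter.Tendsto.matrix_mul {α l m n R : Type*} [Fintype m] [TopologicalSpace R]
    [NonUnitalNonAssocSemiring R] [IsTopologicalSemiring R] {u : Filter α}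
    {f : α → Matrix l m R} {g : α → Matrix m n R} {A : Matrix l m R} {B : Matrix m n R}
    (hf : Tendsto f u (𝓝 A)) (hg : Tendsto g u (𝓝 B)) :
    Tendsto (fun x => f x * g x) u (𝓝 (A * B)) :=
  ((continuous_fst.matrix_mul continuous_snd).tendsto (A, B)).comp (hf.prodMk_nhds hg)

theorem Filter.Tendsto.matrix_fromBlocks {α l m n o R : Type*} [TopologicalSpace R]
    {u : Filter α} {f : α → Matrix n l R} {g : α → Matrix n m R} {h : α → Matrix o l R}
    {k : α → Matrix o m R} {A : Matrix n l R} {B : Matrix n m R} {C : Matrix o l R}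
    {D : Matrix o m R} (hf : Tendsto f u (𝓝 A)) (hg : Tendsto g u (𝓝 B))
    (hh : Tendsto h u (𝓝 C)) (hk : Tendsto k u (𝓝 D)) :
    Tendsto (fun x => fromBlocks (f x) (g x) (h x) (k x)) u (𝓝 (fromBlocks A B C D)) :=
  ((Continuous.matrix_fromBlocks continuous_fst (continuous_fst.comp continuous_snd)
    (continuous_fst.comp (continuous_snd.comp continuous_snd))
    (continuous_snd.comp (continuous_snd.comp continuous_snd))).tendsto (A, B, C, D)).comp
    (hf.prodMk_nhds (hg.prodMk_nhds (hh.prodMk_nhds hk)))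

/-- If a sequence of block matrices `A_n = fromBlocks A₁ₙ A₂ₙ A₃ₙ A₄ₙ`
satisfies: each `A₄ₙ` is invertible with `A₄ₙ⁻¹ → 0`; `Aᵢₙ → Aᵢ` for `i = 1, 2, 3`
with `A₁` invertible; and each Schur complement `A₁ₙ − A₂ₙ A₄ₙ⁻¹ A₃ₙ` is invertible,
then `Aₙ⁻¹ → fromBlocks A₁⁻¹ 0 0 0`. -/
theorem block_inverse_limit {a b : ℕ}
    (A1n : ℕ → Matrix (Fin a) (Fin a) ℝ) (A2n : ℕ → Matrix (Fin a) (Fin b) ℝ)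
    (A3n : ℕ → Matrix (Fin b) (Fin a) ℝ) (A4n : ℕ → Matrix (Fin b) (Fin b) ℝ)
    (A1 : Matrix (Fin a) (Fin a) ℝ) (A2 : Matrix (Fin a) (Fin b) ℝ)
    (A3 : Matrix (Fin b) (Fin a) ℝ)
    (h4inv : ∀ n, IsUnit (A4n n).det)
    (h4 : Tendsto (fun n => (A4n n)⁻¹) atTop (𝓝 0))
    (h1 : Tendsto A1n atTop (𝓝 A1))
    (h2 : Tendsto A2n atTop (𝓝 A2))
    (h3 : Tendsto A3n atTop (𝓝 A3))
    (hA1 : IsUnit A1.det)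
    (hschur : ∀ n, IsUnit (A1n n - A2n n * (A4n n)⁻¹ * A3n n).det) :
    Tendsto (fun n => (Matrix.fromBlocks (A1n n) (A2n n) (A3n n) (A4n n))⁻¹)
      atTop (𝓝 (Matrix.fromBlocks A1⁻¹ 0 0 0)) := by
  have hS : Tendsto (fun n => (A1n n - A2n n * (A4n n)⁻¹ * A3n n)⁻¹) atTop (𝓝 A1⁻¹) := by
    have hlim : Tendsto (fun n => A1n n - A2n n * (A4n n)⁻¹ * A3n n) atTop (𝓝 A1) := by
      simpa using h1.sub ((h2.matrix_mul h4).matrix_mul h3)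
    exact (continuousAt_matrix_inv A1
      (by simpa using continuousAt_inv₀ hA1.ne_zero)).tendsto.comp hlim
  simp only [fun n => inv_fromBlocks_of_isUnit_det₂₂ _ _ _ _ (h4inv n) (hschur n)]
  refine hS.matrix_fromBlocks ?_ ?_ ?_
  · simpa using ((hS.matrix_mul h2).matrix_mul h4).neg
  · simpa using ((h4.matrix_mul h3).matrix_mul hS).neg
  · simpa using h4.add ((((h4.matrix_mul h3).matrix_mul hS).matrix_mul h2).matrix_mul h4)
end

section
/- Let f : ℝ → ℝ be convex and let z ∈ ℝ be a point where f has left derivative ḟ₋(z) and right derivative ḟ₊(z). Let φ be a smoothing kernel with support [−C, C] and let f_h be the kernel-smoothed version of f. Then f_h is differentiable at z for every h > 0, and the derivative satisfies ḟ_h(z) → (ḟ₋(z) + ḟ₊(z))/2 as h → 0^+. -/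
open Filter Matrix Topology MeasureTheory

/-- A smoothing kernel: an infinitely differentiable, nonnegative, even function
`φ` with `φ(0) > 0`, `∫ φ = 1`, and support contained in `[−C, C]`. -/
structure SmoothingKernel where
  φ : ℝ → ℝ
  C : ℝ
  C_pos : 0 < C
  smooth : ContDiff ℝ (⊤ : ℕ∞) φ
  nonneg : ∀ w, 0 ≤ φ w
  even : ∀ w, φ (-w) = φ w
  pos_at_zero : 0 < φ 0
  integral_one : ∫ w, φ w = 1
  support_subset : Function.support φ ⊆ Set.Icc (-C) C

/-- Kernel smoothing: `f_h(z) = (1/h) ∫ f(u) φ((z − u)/h) du`. -/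
noncomputable def smoothed (K : SmoothingKernel) (f : ℝ → ℝ) (h : ℝ) (z : ℝ) : ℝ :=
  (1 / h) * ∫ u, f u * K.φ ((z - u) / h)

/-- Left derivative of `f` at `z`. -/
noncomputable def leftDeriv (f : ℝ → ℝ) (z : ℝ) : ℝ := derivWithin f (Set.Iio z) z

/-- Right derivative of `f` at `z`. -/
noncomputable def rightDeriv (f : ℝ → ℝ) (z : ℝ) : ℝ := derivWithin f (Set.Ioi z) z

namespace SmoothingKernel

variable (K : SmoothingKernel)

lemma hasCompactSupport : HasCompactSupport K.φ :=
  HasCompactSupport.of_support_subset_isCompact isCompact_Icc K.support_subset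

lemma continuous_deriv : Continuous (deriv K.φ) :=
  K.smooth.continuous_deriv (by exact_mod_cast le_top)

lemma hasDerivAt (w : ℝ) : HasDerivAt K.φ (deriv K.φ w) w :=
  (K.smooth.differentiable (by simp) w).hasDerivAt

lemma integrable_mul_deriv {g : ℝ → ℝ} (hg : Continuous g) :
    Integrable (fun w => g w * deriv K.φ w) :=
  (hg.mul K.continuous_deriv).integrable_of_hasCompactSupport K.hasCompactSupport.deriv.mul_left

lemma integrable : Integrable K.φ :=
  K.smooth.continuous.integrable_of_hasCompactSupport K.hasCompactSupport

lemma deriv_eq_zero_of_notMem_Icc {w : ℝ} (hw : w ∉ Set.Icc (-K.C) K.C) : deriv K.φ w = 0 := by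
  by_contra h
  exact hw (closure_minimal K.support_subset isClosed_Icc (support_deriv_subset h))

lemma deriv_neg_arg (w : ℝ) : deriv K.φ (-w) = -deriv K.φ w := by
  have h := deriv_comp_neg K.φ w
  simp only [K.even] at h
  linarith

lemma integral_deriv : ∫ w, deriv K.φ w = 0 :=
  integral_eq_zero_of_hasDerivAt_of_integrable K.hasDerivAt
    (by simpa using K.integrable_mul_deriv (g := fun _ => 1) continuous_const) K.integrable

lemma integral_id_mul_deriv : ∫ w, w * deriv K.φ w = -1 := by
  have h := integral_mul_deriv_eq_deriv_mul_of_integrable (u := fun w : ℝ => w) (v := K.φ)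
    (u' := fun _ => 1) (v' := deriv K.φ) (fun x _ => hasDerivAt_id x)
    (fun x _ => K.hasDerivAt x)
    (K.integrable_mul_deriv continuous_id) (by simpa [Pi.mul_def] using K.integrable)
    ((continuous_id.mul K.smooth.continuous).integrable_of_hasCompactSupport
      K.hasCompactSupport.mul_left)
  simpa [K.integral_one] using h

lemma integral_abs_mul_deriv : ∫ w, |w| * deriv K.φ w = 0 := by
  have h := integral_neg_eq_self (fun w => |w| * deriv K.φ w) volume
  simp only [abs_neg, K.deriv_neg_arg, mul_neg, integral_neg] at h
  linarith

/-- The derivative of the smoothed function, as a weighted average of difference quotients. -/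
lemma hasDerivAt_smoothed {f : ℝ → ℝ} (hf : Continuous f) {h : ℝ} (hh : 0 < h) (z : ℝ) :
    HasDerivAt (smoothed K f h) (∫ w, (f (z - h * w) - f z) / h * deriv K.φ w) z := by
  have hd : ∀ x, HasDerivAt (fun x => K.φ (x / h)) (deriv K.φ (x / h) * (1 / h)) x := fun x =>
    (K.hasDerivAt (x / h)).comp x ((hasDerivAt_id x).div_const h)
  have hcs : HasCompactSupport (fun x => K.φ (x / h)) := by
    simpa [div_eq_inv_mul, Function.comp_def] using
      K.hasCompactSupport.comp_homeomorph (Homeomorph.mulLeft₀ h⁻¹ (inv_ne_zero hh.ne'))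
  have hconv := (hcs.hasDerivAt_convolution_right (ContinuousLinearMap.mul ℝ ℝ)
    hf.locallyIntegrable ((K.smooth.of_le (by exact_mod_cast le_top)).comp
      (contDiff_id.div_const h)) z (μ := volume)).const_mul (1 / h)
  refine HasDerivAt.congr_deriv (f := smoothed K f h) hconv ?_
  have hcv : ∀ F : ℝ → ℝ, ∫ u, F u = h * ∫ w, F (z - h * w) := fun F => by
    rw [Measure.integral_comp_mul_left (fun w => F (z - w)), integral_sub_left_eq_self F volume z,
      abs_of_pos (inv_pos.2 hh), smul_eq_mul, mul_inv_cancel_left₀ hh.ne']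
  have hint : Integrable (fun w => f (z - h * w) / h * deriv K.φ w) :=
    K.integrable_mul_deriv (by fun_prop)
  have hint' : Integrable (fun w => f z / h * deriv K.φ w) :=
    K.integrable_mul_deriv continuous_const
  simp only [convolution, ContinuousLinearMap.mul_apply', fun x => (hd x).deriv]
  rw [hcv]
  simp only [sub_div, sub_mul]
  rw [integral_sub hint hint', integral_const_mul, K.integral_deriv, ← mul_assoc,
    one_div_mul_cancel hh.ne', one_mul, mul_zero, sub_zero]
  refine integral_congr_ae (.of_forall fun w => ?_)
  simp only [sub_sub_cancel, mul_div_cancel_left₀ _ hh.ne']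
  ring

end SmoothingKernel

/-- The scaled difference quotients of a function with one-sided derivatives converge to a
combination of the identity and the absolute value. -/
lemma tendsto_diff_quotient_of_hasDerivWithinAt {f : ℝ → ℝ} {z dl dr : ℝ}
    (hdl : HasDerivWithinAt f dl (Set.Iio z) z) (hdr : HasDerivWithinAt f dr (Set.Ioi z) z)
    (w : ℝ) :
    Tendsto (fun h => (f (z - h * w) - f z) / h) (𝓝[>] (0 : ℝ))
      (𝓝 (-((dl + dr) / 2) * w + (dr - dl) / 2 * |w|)) := by
  have hp : Tendsto (fun h : ℝ => z - h * w) (𝓝[>] 0) (𝓝 z) :=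
    ((by fun_prop : Continuous fun h : ℝ => z - h * w).tendsto' 0 z (by simp)).mono_left
      nhdsWithin_le_nhds
  have key : ∀ (s : Set ℝ) (d : ℝ), HasDerivWithinAt f d s z → z ∉ s → w ≠ 0 →
      (∀ h : ℝ, 0 < h → z - h * w ∈ s) →
      Tendsto (fun h => (f (z - h * w) - f z) / h) (𝓝[>] (0 : ℝ)) (𝓝 (-w * d)) := by
    intro s d hd hs hw hm
    have := ((hasDerivWithinAt_iff_tendsto_slope' hs).1 hd).comp
      (tendsto_nhdsWithin_iff.2 ⟨hp, eventually_mem_nhdsWithin.mono hm⟩)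
    refine (this.const_mul (-w)).congr' (eventually_mem_nhdsWithin.mono fun h hh => ?_)
    have hh' : h ≠ 0 := ne_of_gt hh
    simp only [Function.comp, slope_def_field, sub_sub_cancel_left]
    field_simp
  rcases lt_trichotomy w 0 with hw | rfl | hw
  · convert key (Set.Ioi z) dr hdr (by simp) hw.ne
      (fun h hh => Set.mem_Ioi.2 (by linarith [mul_neg_of_pos_of_neg hh hw])) using 2
    rw [abs_of_neg hw]; ring
  · simp
  · convert key (Set.Iio z) dl hdl (by simp) hw.ne'
      (fun h hh => by simpa using mul_pos hh hw) using 2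
    rw [abs_of_pos hw]; ring

/-- If `f` is convex with one-sided derivatives `dl`, `dr` at `z`,
then the kernel-smoothed `f_h` is differentiable at `z` for every `h > 0`, and
`ḟ_h(z) → (dl + dr)/2` as `h → 0⁺`. -/
theorem smoothed_deriv_tendsto_average (f : ℝ → ℝ)
    (hf : ConvexOn ℝ Set.univ f) (z dl dr : ℝ)
    (hdl : HasDerivWithinAt f dl (Set.Iio z) z)
    (hdr : HasDerivWithinAt f dr (Set.Ioi z) z)
    (K : SmoothingKernel) :
    (∀ h : ℝ, 0 < h → DifferentiableAt ℝ (smoothed K f h) z) ∧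
    Tendsto (fun h => deriv (smoothed K f h) z) (𝓝[>] (0 : ℝ)) (𝓝 ((dl + dr) / 2)) := by
  have hcont : Continuous f := continuousOn_univ.1 (hf.continuousOn isOpen_univ)
  refine ⟨fun h hh => (K.hasDerivAt_smoothed hcont hh z).differentiableAt, ?_⟩
  have hlim : ∫ w, (-((dl + dr) / 2) * w + (dr - dl) / 2 * |w|) * deriv K.φ w = (dl + dr) / 2 := by
    simp only [add_mul, mul_assoc]
    rw [integral_add ((K.integrable_mul_deriv (g := fun w => w) continuous_id).const_mul _)
      ((K.integrable_mul_deriv continuous_abs).const_mul _), integral_const_mul,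
      integral_const_mul, K.integral_id_mul_deriv, K.integral_abs_mul_deriv]
    ring
  rw [← hlim]
  refine Tendsto.congr' (eventually_mem_nhdsWithin.mono fun h hh =>
    (K.hasDerivAt_smoothed hcont hh z).deriv.symm) ?_
  obtain ⟨L, t, ht, hL⟩ := hf.locallyLipschitz z
  obtain ⟨ε, hε, hball⟩ := Metric.mem_nhds_iff.1 ht
  refine tendsto_integral_filter_of_dominated_convergence (fun w => L * |w| * |deriv K.φ w|)
    (.of_forall fun h => (K.integrable_mul_deriv (by fun_prop)).aestronglyMeasurable) ?_ ?_
    (.of_forall fun w => (tendsto_diff_quotient_of_hasDerivWithinAt hdl hdr w).mul_const _)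
  · filter_upwards [Ioo_mem_nhdsGT (div_pos hε K.C_pos)] with h hh
    refine .of_forall fun w => ?_
    by_cases hw : w ∈ Set.Icc (-K.C) K.C
    · have hwC : |w| ≤ K.C := abs_le.2 hw
      have hmem : z - h * w ∈ t := hball <| by
        rw [Metric.mem_ball, Real.dist_eq, sub_sub_cancel_left, abs_neg, abs_mul, abs_of_pos hh.1]
        exact (mul_le_mul_of_nonneg_left hwC hh.1.le).trans_lt ((lt_div_iff₀ K.C_pos).1 hh.2)
      have hLw := hL.dist_le_mul _ hmem _ (mem_of_mem_nhds ht)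
      rw [Real.dist_eq, Real.dist_eq, sub_sub_cancel_left, abs_neg, abs_mul,
        abs_of_pos hh.1] at hLw
      rw [norm_mul, Real.norm_eq_abs, Real.norm_eq_abs, abs_div, abs_of_pos hh.1]
      gcongr
      rw [div_le_iff₀ hh.1]
      linarith
    · simp [K.deriv_eq_zero_of_notMem_Icc hw]
  · have := (K.integrable_mul_deriv (g := fun w => L * |w|) (by fun_prop)).abs
    simpa [abs_mul] using this
end

section
/- Let f : ℝ → ℝ be convex, twice continuously differentiable on a punctured neighborhood of a point z, and suppose z is a zeroth-order singularity of f, i.e. ḟ₋(z) < ḟ₊(z). Let φ be a smoothing kernel with support [−C, C] and φ(0) > 0, and let f_h be the kernel-smoothed version of f. Then f_h is twice differentiable at z for all small h > 0 and f̈_h(z) → +∞ as h → 0^+; more precisely f̈_h(z) ≥ (1/h) φ(0)(ḟ₊(z) − ḟ₋(z)) plus nonnegative terms. -/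
open Filter Matrix Topology MeasureTheory

open scoped Convolution

/-- A function on `ℝ` that is convex on both sides of `z` and has a supporting line at `z`
is convex. -/
lemma convexOn_univ_of_convexOn_Iic_Ici {g : ℝ → ℝ} {z m : ℝ}
    (hl : ConvexOn ℝ (Set.Iic z) g) (hr : ConvexOn ℝ (Set.Ici z) g)
    (hm : ∀ u, g z + m * (u - z) ≤ g u) : ConvexOn ℝ Set.univ g := by
  refine LinearOrder.convexOn_of_lt convex_univ fun x _ y _ hxy a b ha hb hab ↦ ?_
  rcases le_or_gt y z with hyz | hzy
  · exact hl.2 (hxy.le.trans hyz) hyz ha.le hb.le hab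
  rcases le_or_gt z x with hzx | hxz
  · exact hr.2 hzx (hzx.trans hxy.le) ha.le hb.le hab
  obtain rfl : b = 1 - a := by linarith
  have hx := hm x
  have hy := hm y
  simp only [smul_eq_mul]
  rcases le_total (a * x + (1 - a) * y) z with hp | hp
  · set t := (z - (a * x + (1 - a) * y)) / (z - x)
    have htx : t * (z - x) = z - (a * x + (1 - a) * y) :=
      div_mul_cancel₀ _ (by linarith)
    have ht0 : 0 ≤ t := div_nonneg (by linarith) (by linarith)
    have hta : t ≤ a := (div_le_iff₀ (by linarith)).2 (by nlinarith)
    have key := hl.2 (x := x) (y := z) hxz.le Set.self_mem_Iic ht0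
      (show 0 ≤ 1 - t by linarith) (by ring)
    simp only [smul_eq_mul] at key
    rw [show t * x + (1 - t) * z = a * x + (1 - a) * y by linarith] at key
    have h1 := mul_nonneg (sub_nonneg.2 hta) (sub_nonneg.2 hx)
    have h2 := mul_nonneg hb.le (sub_nonneg.2 hy)
    linear_combination key + h1 + h2 - m * htx
  · set t := ((a * x + (1 - a) * y) - z) / (y - z)
    have hty : t * (y - z) = (a * x + (1 - a) * y) - z :=
      div_mul_cancel₀ _ (by linarith)
    have ht0 : 0 ≤ t := div_nonneg (by linarith) (by linarith)
    have htb : t ≤ 1 - a := (div_le_iff₀ (by linarith)).2 (by nlinarith)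
    have key := hr.2 (x := y) (y := z) hzy.le Set.self_mem_Ici ht0
      (show 0 ≤ 1 - t by linarith) (by ring)
    simp only [smul_eq_mul] at key
    rw [show t * y + (1 - t) * z = a * x + (1 - a) * y by linarith] at key
    have h1 := mul_nonneg (sub_nonneg.2 htb) (sub_nonneg.2 hy)
    have h2 := mul_nonneg ha.le (sub_nonneg.2 hx)
    linear_combination key + h1 + h2 + m * hty

/-- Removing the kink of a convex function at `z` leaves a convex function. -/
lemma ConvexOn.sub_jump_mul_posPart {f : ℝ → ℝ} (hf : ConvexOn ℝ Set.univ f) {z dl dr : ℝ}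
    (hdl : HasDerivWithinAt f dl (Set.Iio z) z) (hdr : HasDerivWithinAt f dr (Set.Ioi z) z) :
    ConvexOn ℝ Set.univ fun u ↦ f u - (dr - dl) * max (u - z) 0 := by
  refine convexOn_univ_of_convexOn_Iic_Ici (z := z) (m := dl) ?_ ?_ fun u ↦ ?_
  · refine (hf.subset (Set.subset_univ _) (convex_Iic z)).congr fun u hu ↦ ?_
    simp [max_eq_right (sub_nonpos.2 (Set.mem_Iic.1 hu))]
  · have haff : ConvexOn ℝ (Set.Ici z) fun u : ℝ ↦ -((dr - dl) * (u - z)) :=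
      ⟨convex_Ici z, fun x _ y _ a b _ _ hab ↦ le_of_eq (by
        obtain rfl : b = 1 - a := by linarith
        simp only [smul_eq_mul]
        ring)⟩
    refine ((hf.subset (Set.subset_univ _) (convex_Ici z)).add haff).congr fun u hu ↦ ?_
    simp only [Pi.add_apply, max_eq_left (sub_nonneg.2 (Set.mem_Ici.1 hu))]
    ring
  · rcases lt_trichotomy u z with hu | rfl | hu
    · have h := hf.slope_le_of_hasDerivWithinAt_Iio (Set.mem_univ u) (Set.mem_univ z) hu hdl
      rw [slope_def_field, div_le_iff₀ (sub_pos.2 hu)] at h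
      simp only [sub_self, max_self, max_eq_right (sub_nonpos.2 hu.le)]
      linarith
    · simp
    · have h := hf.le_slope_of_hasDerivWithinAt_Ioi (Set.mem_univ z) (Set.mem_univ u) hu hdr
      rw [slope_def_field, le_div_iff₀ (sub_pos.2 hu)] at h
      simp only [sub_self, max_self, max_eq_left (sub_nonneg.2 hu.le)]
      linarith

/-- The convolution of a convex function with a nonnegative, continuous, compactly supported
function is convex. -/
lemma ConvexOn.convolution_right {g ψ : ℝ → ℝ} (hg : ConvexOn ℝ Set.univ g)
    (hψ : Continuous ψ) (hc : HasCompactSupport ψ) (h0 : ∀ w, 0 ≤ ψ w) :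
    ConvexOn ℝ Set.univ (g ⋆[ContinuousLinearMap.mul ℝ ℝ] ψ) := by
  have hgc : Continuous g := continuousOn_univ.1 (hg.continuousOn isOpen_univ)
  have hint (x : ℝ) : Integrable fun t ↦ g (x - t) * ψ t :=
    ((by fun_prop : Continuous fun t ↦ g (x - t) * ψ t)).integrable_of_hasCompactSupport
      hc.mul_left
  refine ⟨convex_univ, fun x _ y _ a b ha hb hab ↦ ?_⟩
  simp only [convolution_mul_swap, smul_eq_mul]
  rw [← integral_const_mul, ← integral_const_mul,
    ← integral_add ((hint x).const_mul a) ((hint y).const_mul b)]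
  refine integral_mono (hint _) (((hint x).const_mul a).add ((hint y).const_mul b)) fun t ↦ ?_
  have h := mul_le_mul_of_nonneg_right
    (hg.2 (Set.mem_univ (x - t)) (Set.mem_univ (y - t)) ha hb hab) (h0 t)
  simp only [smul_eq_mul] at h
  rw [show a * (x - t) + b * (y - t) = a * x + b * y - t by linear_combination -t * hab] at h
  simp only
  linarith

section Convolution

variable {g ψ : ℝ → ℝ}

lemma deriv_convolution_right (hg : Continuous g) (hψ : ContDiff ℝ 2 ψ)
    (hc : HasCompactSupport ψ) :
    deriv (g ⋆[ContinuousLinearMap.mul ℝ ℝ] ψ) =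
      g ⋆[ContinuousLinearMap.mul ℝ ℝ] (deriv ψ) :=
  funext fun x ↦ (hc.hasDerivAt_convolution_right _ hg.locallyIntegrable
    (hψ.of_le one_le_two) x).deriv

lemma hasDerivAt_deriv_convolution_right (hg : Continuous g) (hψ : ContDiff ℝ 2 ψ)
    (hc : HasCompactSupport ψ) (x : ℝ) :
    HasDerivAt (deriv (g ⋆[ContinuousLinearMap.mul ℝ ℝ] ψ))
      ((g ⋆[ContinuousLinearMap.mul ℝ ℝ] (deriv (deriv ψ))) x) x := by
  rw [deriv_convolution_right hg hψ hc]
  exact hc.deriv.hasDerivAt_convolution_right _ hg.locallyIntegrable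
    (ContDiff.deriv' (n := 1) hψ) x

/-- Convolving a convex function with the second derivative of a nonnegative bump function gives
a nonnegative function. -/
lemma ConvexOn.convolution_deriv_deriv_nonneg (hg : ConvexOn ℝ Set.univ g)
    (hψ : ContDiff ℝ 2 ψ) (hc : HasCompactSupport ψ) (h0 : ∀ w, 0 ≤ ψ w) (x : ℝ) :
    0 ≤ (g ⋆[ContinuousLinearMap.mul ℝ ℝ] (deriv (deriv ψ))) x := by
  have hgc : Continuous g := continuousOn_univ.1 (hg.continuousOn isOpen_univ)
  have hmono : Monotone (deriv (g ⋆[ContinuousLinearMap.mul ℝ ℝ] ψ)) :=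
    monotoneOn_univ.1 <| (hg.convolution_right hψ.continuous hc h0).monotoneOn_deriv fun x _ ↦
      (hc.hasDerivAt_convolution_right _ hgc.locallyIntegrable
        (hψ.of_le one_le_two) x).differentiableAt
  rw [← (hasDerivAt_deriv_convolution_right hgc hψ hc x).deriv]
  exact hmono.deriv_nonneg

/-- The second derivative of the ramp `u ↦ max (u - z) 0` is the Dirac mass at `z`. -/
lemma posPart_convolution_deriv_deriv (hψ : ContDiff ℝ 2 ψ) (hc : HasCompactSupport ψ) (z : ℝ) :
    ((fun u ↦ max (u - z) 0) ⋆[ContinuousLinearMap.mul ℝ ℝ] (deriv (deriv ψ))) z = ψ 0 := by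
  have hψ1 : ContDiff ℝ 1 (deriv ψ) := ContDiff.deriv' (n := 1) hψ
  set F : ℝ → ℝ := fun u ↦ -((u - z) * deriv ψ (z - u)) - ψ (z - u) with hF
  have hFd : ContDiff ℝ 1 F := by
    have := hψ.of_le (one_le_two (α := WithTop ℕ∞))
    fun_prop
  have hcomp {χ : ℝ → ℝ} (hχ : HasCompactSupport χ) : HasCompactSupport fun u ↦ χ (z - u) :=
    hχ.comp_homeomorph (Homeomorph.subLeft z)
  have hFc : HasCompactSupport F :=
    ((hcomp hc.deriv).mul_left (f := fun u ↦ u - z)).neg.sub (hcomp hc)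
  have hF' (u : ℝ) : deriv F u = (u - z) * deriv (deriv ψ) (z - u) := by
    have hzu : HasDerivAt (fun u ↦ z - u) (-1) u := by
      simpa using (hasDerivAt_id u).const_sub z
    have h1 : HasDerivAt (fun u ↦ ψ (z - u)) (deriv ψ (z - u) * -1) u :=
      ((hψ.differentiable two_ne_zero) (z - u)).hasDerivAt.comp u hzu
    have h2 : HasDerivAt (fun u ↦ deriv ψ (z - u)) (deriv (deriv ψ) (z - u) * -1) u :=
      ((hψ1.differentiable one_ne_zero) (z - u)).hasDerivAt.comp u hzu
    have h3 : HasDerivAt F _ u := ((((hasDerivAt_id u).sub_const z).mul h2).neg).sub h1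
    rw [h3.deriv]
    simp only [id]
    ring
  rw [convolution_mul, ← setIntegral_eq_integral_of_forall_compl_eq_zero (s := Set.Ioi z)]
  · rw [setIntegral_congr_fun (g := deriv F) measurableSet_Ioi fun u hu ↦ by
      rw [hF' u, max_eq_left (sub_nonneg.2 (le_of_lt hu))], hFc.integral_Ioi_deriv_eq hFd]
    simp [hF]
  · intro u hu
    rw [max_eq_right (sub_nonpos.2 (not_lt.1 hu)), zero_mul]

end Convolution

namespace SmoothingKernel

variable (K : SmoothingKernel)

/-- The dilated kernel `w ↦ φ (w / h)`. -/
noncomputable def dilate (h : ℝ) : ℝ → ℝ := fun w ↦ K.φ (w / h)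

lemma contDiff_dilate (h : ℝ) : ContDiff ℝ 2 (K.dilate h) :=
  (K.smooth.of_le (WithTop.coe_le_coe.2 (le_top : (2 : ℕ∞) ≤ ⊤))).comp (contDiff_id.div_const h)

lemma hasCompactSupport_dilate {h : ℝ} (hh : h ≠ 0) : HasCompactSupport (K.dilate h) := by
  have hφ : HasCompactSupport K.φ :=
    HasCompactSupport.of_support_subset_isCompact isCompact_Icc K.support_subset
  have := hφ.comp_smul (inv_ne_zero hh)
  simp only [smul_eq_mul, ← div_eq_inv_mul] at this
  exact this

end SmoothingKernel

lemma smoothed_eq_smul_convolution (K : SmoothingKernel) (f : ℝ → ℝ) (h : ℝ) :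
    smoothed K f h = (1 / h) • (f ⋆[ContinuousLinearMap.mul ℝ ℝ] (K.dilate h)) :=
  rfl

/-- The second derivative of the smoothed function at a kink of a convex function is at least
`φ(0) / h` times the jump of the derivative. -/
lemma jump_le_convolution_deriv_deriv {f : ℝ → ℝ} (hf : ConvexOn ℝ Set.univ f) {z dl dr : ℝ}
    (hdl : HasDerivWithinAt f dl (Set.Iio z) z) (hdr : HasDerivWithinAt f dr (Set.Ioi z) z)
    {ψ : ℝ → ℝ} (hψ : ContDiff ℝ 2 ψ) (hc : HasCompactSupport ψ) (h0 : ∀ w, 0 ≤ ψ w) :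
    (dr - dl) * ψ 0 ≤ (f ⋆[ContinuousLinearMap.mul ℝ ℝ] (deriv (deriv ψ))) z := by
  have hg := hf.sub_jump_mul_posPart hdl hdr
  have hnonneg := hg.convolution_deriv_deriv_nonneg hψ hc h0 z
  have hψ2 : Continuous (deriv (deriv ψ)) :=
    (ContDiff.deriv' (n := 1) hψ).continuous_deriv le_rfl
  have hint {k : ℝ → ℝ} (hk : Continuous k) :
      Integrable fun u ↦ k u * deriv (deriv ψ) (z - u) :=
    (by fun_prop : Continuous fun u ↦ k u * deriv (deriv ψ) (z - u)).integrable_of_hasCompactSupport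
      (hc.deriv.deriv.comp_homeomorph (Homeomorph.subLeft z)).mul_left
  have hsplit : (f ⋆[ContinuousLinearMap.mul ℝ ℝ] (deriv (deriv ψ))) z =
      ((fun u ↦ f u - (dr - dl) * max (u - z) 0) ⋆[ContinuousLinearMap.mul ℝ ℝ]
        (deriv (deriv ψ))) z +
      (dr - dl) * ((fun u ↦ max (u - z) 0) ⋆[ContinuousLinearMap.mul ℝ ℝ]
        (deriv (deriv ψ))) z := by
    simp only [convolution_mul]
    rw [← integral_const_mul, ← integral_add
      (hint (continuousOn_univ.1 (hg.continuousOn isOpen_univ)))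
      ((hint (by fun_prop)).const_mul _)]
    congr 1 with u
    ring
  rw [hsplit, posPart_convolution_deriv_deriv hψ hc]
  linarith

/-- If `f` is convex, twice continuously differentiable on a punctured
neighborhood of `z`, and `z` is a zeroth-order singularity (`dl < dr`), then for all
small `h > 0` the smoothed `f_h` is twice differentiable at `z` with
`f̈_h(z) ≥ (1/h) φ(0) (dr − dl)`, and `f̈_h(z) → +∞` as `h → 0⁺`. -/
theorem smoothed_second_deriv_tendsto_atTop (f : ℝ → ℝ)
    (hf : ConvexOn ℝ Set.univ f) (z dl dr : ℝ)
    (hdl : HasDerivWithinAt f dl (Set.Iio z) z)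
    (hdr : HasDerivWithinAt f dr (Set.Ioi z) z)
    (hsing : dl < dr)
    (hC2 : ∃ ε > 0, ContDiffOn ℝ 2 f (Set.Ioo (z - ε) (z + ε) \ {z}))
    (K : SmoothingKernel) :
    (∀ᶠ h in 𝓝[>] (0 : ℝ),
        DifferentiableAt ℝ (smoothed K f h) z ∧
        DifferentiableAt ℝ (deriv (smoothed K f h)) z ∧
        (1 / h) * K.φ 0 * (dr - dl) ≤ deriv (deriv (smoothed K f h)) z) ∧
    Tendsto (fun h => deriv (deriv (smoothed K f h)) z) (𝓝[>] (0 : ℝ)) atTop := by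
  have hfc : Continuous f := continuousOn_univ.1 (hf.continuousOn isOpen_univ)
  have main : ∀ᶠ h in 𝓝[>] (0 : ℝ),
      DifferentiableAt ℝ (smoothed K f h) z ∧
      DifferentiableAt ℝ (deriv (smoothed K f h)) z ∧
      (1 / h) * K.φ 0 * (dr - dl) ≤ deriv (deriv (smoothed K f h)) z := by
    filter_upwards [self_mem_nhdsWithin] with h (hh : 0 < h)
    have hψ := K.contDiff_dilate h
    have hc := K.hasCompactSupport_dilate hh.ne'
    have hd (x : ℝ) := hc.hasDerivAt_convolution_right (ContinuousLinearMap.mul ℝ ℝ)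
      (μ := volume)
      hfc.locallyIntegrable (hψ.of_le one_le_two) x
    have hderiv : deriv (smoothed K f h) =
        (1 / h) • deriv (f ⋆[ContinuousLinearMap.mul ℝ ℝ] (K.dilate h)) := by
      rw [smoothed_eq_smul_convolution]
      exact funext fun x ↦ deriv_const_smul _ (hd x).differentiableAt
    have hd2 := (hasDerivAt_deriv_convolution_right hfc hψ hc z).const_smul (1 / h)
    rw [hderiv, hd2.deriv]
    refine ⟨?_, hd2.differentiableAt, ?_⟩
    · rw [smoothed_eq_smul_convolution]
      exact (hd z).differentiableAt.const_smul _
    · have hjump := mul_le_mul_of_nonneg_left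
        (jump_le_convolution_deriv_deriv hf hdl hdr hψ hc fun w ↦ K.nonneg _)
        (one_div_pos.2 hh).le
      have h0 : K.dilate h 0 = K.φ 0 := by simp [SmoothingKernel.dilate]
      rw [h0] at hjump
      rw [smul_eq_mul]
      linarith
  refine ⟨main, tendsto_atTop_mono' _ (main.mono fun h hh ↦ hh.2.2) ?_⟩
  simp only [one_div]
  exact (tendsto_inv_nhdsGT_zero.atTop_mul_const K.pos_at_zero).atTop_mul_const
    (sub_pos.2 hsing)
end

section
/- Let x_1,…,x_n ∈ ℝ^p and y_1,…,y_n ∈ ℝ, let ℓ(·; y) : ℝ → ℝ be convex, continuous, and nonnegative, let λ > 0, and let r : ℝ → ℝ be convex, coercive, and locally Lipschitz (for every A > 0 there is L_A with |r(x) − r(y)| ≤ L_A|x − y| on [−A, A]). Let φ be a smoothing kernel with support [−C, C] and let r_h be the kernel-smoothed version of r. Suppose P(β) = Σ_j ℓ(x_j^T β; y_j) + λ Σ_l r(β_l) has a unique minimizer β̂, and for each 0 < h ≤ 1 let β̂_h be a minimizer of P_h(β) = Σ_j ℓ(x_j^T β; y_j) + λ Σ_l r_h(β_l). Then ‖β̂_h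 − β̂‖₂ → 0 as h → 0^+. -/
open Filter Matrix Topology MeasureTheory

namespace SmoothingKernel

variable (K : SmoothingKernel)

lemma eq_zero_of_notMem_Icc {w : ℝ} (hw : w ∉ Set.Icc (-K.C) K.C) : K.φ w = 0 := by
  by_contra h
  exact hw (K.support_subset h)

lemma integrable_mul {g : ℝ → ℝ} (hg : Continuous g) : Integrable fun w => g w * K.φ w :=
  (hg.mul K.smooth.continuous).integrable_of_hasCompactSupport K.hasCompactSupport.mul_left

end SmoothingKernel

lemma smoothed_eq_integral (K : SmoothingKernel) (f : ℝ → ℝ) {h : ℝ} (hh : 0 < h) (z : ℝ) :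
    smoothed K f h z = ∫ w, f (z - h * w) * K.φ w := by
  have hscale := Measure.integral_comp_mul_left (fun v => f (z - v) * K.φ (v / h)) h
  simp only [mul_div_cancel_left₀ _ hh.ne', smul_eq_mul, abs_of_pos (inv_pos.2 hh)] at hscale
  rw [smoothed, hscale, one_div, ← integral_sub_left_eq_self _ volume z]
  simp only [sub_sub_cancel]

/-- Smoothing a convex function with an even kernel does not decrease it. -/
lemma le_smoothed (K : SmoothingKernel) {f : ℝ → ℝ} (hf : ConvexOn ℝ Set.univ f)
    (hcont : Continuous f) {h : ℝ} (hh : 0 < h) (z : ℝ) : f z ≤ smoothed K f h z := by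
  rw [smoothed_eq_integral K f hh]
  have hint₁ : Integrable fun w => f (z - h * w) * K.φ w := K.integrable_mul (by fun_prop)
  have hint₂ : Integrable fun w => f (z + h * w) * K.φ w := K.integrable_mul (by fun_prop)
  have hrefl : ∫ w, f (z + h * w) * K.φ w = ∫ w, f (z - h * w) * K.φ w := by
    rw [← integral_neg_eq_self]
    simp only [K.even, mul_neg, sub_eq_add_neg]
  have hmid : ∫ w, 2 * f z * K.φ w ≤ ∫ w, (f (z - h * w) * K.φ w + f (z + h * w) * K.φ w) := by
    refine integral_mono (K.integrable_mul continuous_const) (hint₁.add hint₂) fun w => ?_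
    have hconv := hf.2 (Set.mem_univ (z - h * w)) (Set.mem_univ (z + h * w))
      one_half_pos.le one_half_pos.le (add_halves 1)
    simp only [smul_eq_mul] at hconv
    rw [show 1 / 2 * (z - h * w) + 1 / 2 * (z + h * w) = z by ring] at hconv
    rw [← add_mul]
    exact mul_le_mul_of_nonneg_right (by linarith) (K.nonneg w)
  rw [integral_add hint₁ hint₂, hrefl, integral_const_mul, K.integral_one] at hmid
  linarith

lemma tendsto_smoothed (K : SmoothingKernel) {f : ℝ → ℝ} (hcont : Continuous f) (z : ℝ) :
    Tendsto (fun h => smoothed K f h z) (𝓝[>] 0) (𝓝 (f z)) := by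
  have hφ := K.smooth.continuous
  have hG : Continuous fun h : ℝ => ∫ w in Set.Icc (-K.C) K.C, f (z - h * w) * K.φ w :=
    continuous_parametric_integral_of_continuous (by fun_prop) isCompact_Icc
  have hset (h : ℝ) : ∫ w in Set.Icc (-K.C) K.C, f (z - h * w) * K.φ w
      = ∫ w, f (z - h * w) * K.φ w :=
    setIntegral_eq_integral_of_forall_compl_eq_zero fun w hw => by
      rw [K.eq_zero_of_notMem_Icc hw, mul_zero]
  simp only [hset] at hG
  have hlim := hG.tendsto 0
  simp only [zero_mul, sub_zero, integral_const_mul, K.integral_one, mul_one] at hlim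
  refine (hlim.mono_left nhdsWithin_le_nhds).congr' ?_
  filter_upwards [self_mem_nhdsWithin] with h hh
  exact (smoothed_eq_integral K f hh z).symm

/-- Minimizing nets of a continuous function with relatively compact sublevel sets converge to
its unique minimizer. -/
lemma tendsto_of_tendsto_unique_minimizer {ι X : Type*} [TopologicalSpace X] {F : X → ℝ}
    (hF : Continuous F) (hsub : ∀ M, ∃ S, IsCompact S ∧ ∀ a, F a ≤ M → a ∈ S)
    {a₀ : X} (hmin : ∀ a, a ≠ a₀ → F a₀ < F a) {u : ι → X} {L : Filter ι}
    (hu : Tendsto (fun i => F (u i)) L (𝓝 (F a₀))) : Tendsto u L (𝓝 a₀) := by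
  obtain ⟨S, hS, hmem⟩ := hsub (F a₀ + 1)
  refine hS.tendsto_nhds_of_unique_mapClusterPt ?_ fun a _ ha => ?_
  · filter_upwards [hu.eventually (gt_mem_nhds (lt_add_one (F a₀)))] with i hi
    exact hmem _ hi.le
  · by_contra hne
    have hcluster : MapClusterPt (F a) L fun i => F (u i) := ha.continuousAt_comp hF.continuousAt
    have : (𝓝 (F a) ⊓ 𝓝 (F a₀)).NeBot := hcluster.neBot.mono (inf_le_inf_left _ hu)
    exact (hmin a hne).ne' (eq_of_nhds_neBot this)

/-- A separable sum of coercive continuous functions has relatively compact sublevel sets. -/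
lemma exists_isCompact_of_sum_le {ι : Type*} [Fintype ι] {r : ℝ → ℝ} (hcont : Continuous r)
    (hcoer : Tendsto r (cocompact ℝ) atTop) (M : ℝ) :
    ∃ S : Set (ι → ℝ), IsCompact S ∧ ∀ β, ∑ l, r (β l) ≤ M → β ∈ S := by
  classical
  obtain ⟨t₀, ht₀⟩ := hcont.exists_forall_le hcoer
  obtain ⟨T, hT, hTsub⟩ := mem_cocompact.1
    (hcoer.eventually (eventually_gt_atTop (M - Fintype.card ι * r t₀ + r t₀)))
  refine ⟨Set.univ.pi fun _ => T, isCompact_univ_pi fun _ => hT, fun β hβ l _ => ?_⟩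
  by_contra hl
  have hlarge : M - Fintype.card ι * r t₀ + r t₀ < r (β l) := hTsub hl
  have hsingle : r (β l) - r t₀ ≤ ∑ k, (r (β k) - r t₀) :=
    Finset.single_le_sum (f := fun k => r (β k) - r t₀)
      (fun k _ => sub_nonneg.2 (ht₀ _)) (Finset.mem_univ l)
  rw [Finset.sum_sub_distrib, Finset.sum_const, Finset.card_univ, nsmul_eq_mul] at hsingle
  linarith

/-- For a convex, continuous, nonnegative loss, `λ > 0`, and a
convex, coercive, locally Lipschitz regularizer `r`, if `β̂` is the unique minimizer
of the penalized objective and `β̂_h` are minimizers of the kernel-smoothed objectives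
(for `0 < h ≤ 1`), then `‖β̂_h − β̂‖₂ → 0` as `h → 0⁺`. -/
theorem smoothed_minimizers_converge {n p : ℕ}
    (x : Fin n → Fin p → ℝ) (y : Fin n → ℝ)
    (ℓ : ℝ → ℝ → ℝ)
    (hℓconv : ∀ a : ℝ, ConvexOn ℝ Set.univ fun u => ℓ u a)
    (hℓcont : ∀ a : ℝ, Continuous fun u => ℓ u a)
    (hℓpos : ∀ u a : ℝ, 0 ≤ ℓ u a)
    (lam : ℝ) (hlam : 0 < lam)
    (r : ℝ → ℝ)
    (hrconv : ConvexOn ℝ Set.univ r)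
    (hrcoer : Tendsto r (cocompact ℝ) atTop)
    (hrlip : ∀ A > (0 : ℝ), ∃ LA : ℝ, ∀ s ∈ Set.Icc (-A) A, ∀ t ∈ Set.Icc (-A) A,
      |r s - r t| ≤ LA * |s - t|)
    (K : SmoothingKernel)
    (βhat : Fin p → ℝ)
    (hβhat : ∀ β : Fin p → ℝ, β ≠ βhat →
      (∑ j, ℓ (x j ⬝ᵥ βhat) (y j)) + lam * ∑ l, r (βhat l)
        < (∑ j, ℓ (x j ⬝ᵥ β) (y j)) + lam * ∑ l, r (β l))
    (βh : ℝ → Fin p → ℝ)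
    (hβh : ∀ h : ℝ, 0 < h → h ≤ 1 → ∀ β : Fin p → ℝ,
      (∑ j, ℓ (x j ⬝ᵥ βh h) (y j)) + lam * ∑ l, smoothed K r h (βh h l)
        ≤ (∑ j, ℓ (x j ⬝ᵥ β) (y j)) + lam * ∑ l, smoothed K r h (β l)) :
    Tendsto (fun h => Real.sqrt (∑ l, (βh h l - βhat l) ^ 2)) (𝓝[>] (0 : ℝ)) (𝓝 0) := by
  have hcont : Continuous r := continuousOn_univ.1 (hrconv.continuousOn isOpen_univ)
  have hloss : Continuous fun β : Fin p → ℝ => ∑ j, ℓ (x j ⬝ᵥ β) (y j) :=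
    continuous_finsetSum _ fun j _ => (hℓcont (y j)).comp (by fun_prop)
  have hmin : Tendsto βh (𝓝[>] 0) (𝓝 βhat) := by
    refine tendsto_of_tendsto_unique_minimizer
      (F := fun β => (∑ j, ℓ (x j ⬝ᵥ β) (y j)) + lam * ∑ l, r (β l))
      (hloss.add (by fun_prop)) (fun M => ?_) hβhat ?_
    · obtain ⟨S, hS, hmem⟩ := exists_isCompact_of_sum_le (ι := Fin p) hcont hrcoer (M / lam)
      refine ⟨S, hS, fun β hβ => hmem β ((le_div_iff₀' hlam).2 ?_)⟩
      have hnonneg : 0 ≤ ∑ j, ℓ (x j ⬝ᵥ β) (y j) := Finset.sum_nonneg fun j _ => hℓpos _ _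
      linarith
    · have hupper : Tendsto
          (fun h => (∑ j, ℓ (x j ⬝ᵥ βhat) (y j)) + lam * ∑ l, smoothed K r h (βhat l))
          (𝓝[>] 0) (𝓝 ((∑ j, ℓ (x j ⬝ᵥ βhat) (y j)) + lam * ∑ l, r (βhat l))) :=
        ((tendsto_finsetSum _ fun l _ => tendsto_smoothed K hcont (βhat l)).const_mul
          lam).const_add _
      refine tendsto_of_tendsto_of_tendsto_of_le_of_le' tendsto_const_nhds hupper ?_ ?_
      · refine Eventually.of_forall fun h => ?_
        rcases eq_or_ne (βh h) βhat with heq | hne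
        · rw [heq]
        · exact (hβhat _ hne).le
      · filter_upwards [Ioc_mem_nhdsGT (zero_lt_one' ℝ)] with h hh
        refine le_trans ?_ (hβh h hh.1 hh.2 βhat)
        gcongr with l
        exact le_smoothed K hrconv hcont hh.1 _
  have hdist : Continuous fun β : Fin p → ℝ => Real.sqrt (∑ l, (β l - βhat l) ^ 2) := by fun_prop
  simpa [Function.comp_def] using (hdist.tendsto βhat).comp hmin
end

section
/- Let Γ ∈ ℝ^{p×k} have orthonormal columns (Γ^T Γ = I_k), and let V ∈ ℝ^{p×p} be such that Γ^T V Γ is invertible. Then the matrix I − ΓΓ^T + ΓΓ^T V is invertible, and (I − ΓΓ^T + ΓΓ^T V)^{-1} ΓΓ^T = Γ (Γ^T V Γ)^{-1} Γ^T. Moreover, the right-hand side is unchanged if Γ is replaced by ΓO for any orthogonal matrix O ∈ ℝ^{k×k}. -/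
open Matrix

section

variable {m n R : Type*} [Fintype m] [Fintype n] [DecidableEq n] [CommRing R]

theorem Matrix.det_one_sub_mul_transpose_add [DecidableEq m] (A : Matrix m n R)
    (hA : Aᵀ * A = 1) (V : Matrix m m R) : (1 - A * Aᵀ + A * Aᵀ * V).det = (Aᵀ * V * A).det := by
  have h : 1 - A * Aᵀ + A * Aᵀ * V = 1 + A * (Aᵀ * V - Aᵀ) := by
    rw [Matrix.mul_sub, Matrix.mul_assoc]
    abel
  rw [h, det_one_add_mul_comm, Matrix.sub_mul, hA, add_sub_cancel]

theorem Matrix.one_sub_mul_transpose_add_mul [DecidableEq m] (A : Matrix m n R)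
    (hA : Aᵀ * A = 1) (V : Matrix m m R) : (1 - A * Aᵀ + A * Aᵀ * V) * A = A * (Aᵀ * V * A) := by
  rw [Matrix.add_mul, Matrix.sub_mul, Matrix.mul_assoc A Aᵀ A, hA]
  simp [Matrix.mul_assoc]

theorem Matrix.mul_inv_mul_transpose_orthogonal (A : Matrix m n R) (V : Matrix m m R)
    (O : Matrix n n R) (hO : O * Oᵀ = 1) :
    (A * O) * ((A * O)ᵀ * V * (A * O))⁻¹ * (A * O)ᵀ = A * (Aᵀ * V * A)⁻¹ * Aᵀ := by
  have h : (A * O)ᵀ * V * (A * O) = Oᵀ * (Aᵀ * V * A) * O := by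
    simp only [transpose_mul, Matrix.mul_assoc]
  rw [h, mul_inv_rev, mul_inv_rev, inv_eq_right_inv hO, inv_eq_left_inv hO, transpose_mul]
  calc A * O * (Oᵀ * ((Aᵀ * V * A)⁻¹ * O)) * (Oᵀ * Aᵀ)
      = A * (O * Oᵀ) * (Aᵀ * V * A)⁻¹ * (O * Oᵀ) * Aᵀ := by simp only [Matrix.mul_assoc]
    _ = A * (Aᵀ * V * A)⁻¹ * Aᵀ := by simp only [hO, Matrix.mul_one]

end

/-- For `Γ ∈ ℝ^{p×k}` with orthonormal columns and `V` with
`ΓᵀVΓ` invertible, the matrix `I − ΓΓᵀ + ΓΓᵀV` is invertible and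
`(I − ΓΓᵀ + ΓΓᵀV)⁻¹ ΓΓᵀ = Γ(ΓᵀVΓ)⁻¹Γᵀ`; moreover the right-hand side is invariant
under replacing `Γ` by `ΓO` for any orthogonal `O`. -/
theorem polyhedron_constraint_G_formula {p k : ℕ}
    (Γ : Matrix (Fin p) (Fin k) ℝ) (hΓ : Γᵀ * Γ = 1)
    (V : Matrix (Fin p) (Fin p) ℝ)
    (hV : IsUnit (Γᵀ * V * Γ).det) :
    IsUnit ((1 : Matrix (Fin p) (Fin p) ℝ) - Γ * Γᵀ + Γ * Γᵀ * V).det ∧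
    ((1 : Matrix (Fin p) (Fin p) ℝ) - Γ * Γᵀ + Γ * Γᵀ * V)⁻¹ * (Γ * Γᵀ)
      = Γ * (Γᵀ * V * Γ)⁻¹ * Γᵀ ∧
    ∀ O : Matrix (Fin k) (Fin k) ℝ, Oᵀ * O = 1 → O * Oᵀ = 1 →
      (Γ * O) * ((Γ * O)ᵀ * V * (Γ * O))⁻¹ * (Γ * O)ᵀ = Γ * (Γᵀ * V * Γ)⁻¹ * Γᵀ := by
  have hM := hV
  rw [← det_one_sub_mul_transpose_add Γ hΓ V] at hM
  refine ⟨hM, ?_, fun O _ hO => mul_inv_mul_transpose_orthogonal Γ V O hO⟩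
  have h : (1 - Γ * Γᵀ + Γ * Γᵀ * V) * (Γ * (Γᵀ * V * Γ)⁻¹ * Γᵀ) = Γ * Γᵀ := by
    rw [← Matrix.mul_assoc, ← Matrix.mul_assoc, one_sub_mul_transpose_add_mul Γ hΓ,
      mul_nonsing_inv_cancel_right _ _ hV]
  exact (congrArg ((1 - Γ * Γᵀ + Γ * Γᵀ * V)⁻¹ * ·) h.symm).trans
    (nonsing_inv_mul_cancel_left _ _ hM)
end
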